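/- arXiv:1812.09876 — 2 statements merged into one kernel-verified Lean document; each statement's English description precedes it below -/
import Mathlib

section
/- Let c₁, c₂, c₃ be real numbers with c₁ ≥ c₂ ≥ −c₃ ≥ 0 (so c₃ ≤ 0) and c₁ + c₂ + c₃ ≤ 1. Then the Bell-diagonal matrix τ admits the decomposition τ = |c₃| β₀₁ + 2(λ₀₀ − λ₁₁)·(β₀₀ + β₀₁)/2 + 2λ₁₀·(β₀₁ + β₁₀)/2 + 2λ₁₁·(β₀₀ + β₁₁)/2, where all the coefficients |c₃|, 2(λ₀₀ − λ₁₁), 2λ₁₀, 2λ₁₁ are nonnegative and sum to 1. (This exhibits τ as a convex mixture of the entangled projector β₀₁ with weight |c₃| and a separable state with weight 1 − |c₃|.) -/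
open Matrix
open scoped Matrix Kronecker

/-- The three Pauli matrices σx, σy, σz. -/
noncomputable def pauli : Fin 3 → Matrix (Fin 2) (Fin 2) ℂ
  | 0 => !![0, 1; 1, 0]
  | 1 => !![0, -Complex.I; Complex.I, 0]
  | 2 => !![1, 0; 0, -1]

/-- The Bell-diagonal matrix τ = (1/4)(I⊗I + c₁ σ₁⊗σ₁ + c₂ σ₂⊗σ₂ + c₃ σ₃⊗σ₃). -/
noncomputable def bellDiag (c₁ c₂ c₃ : ℝ) : Matrix (Fin 2 × Fin 2) (Fin 2 × Fin 2) ℂ :=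
  (1 / 4 : ℂ) • ((1 : Matrix (Fin 2) (Fin 2) ℂ) ⊗ₖ (1 : Matrix (Fin 2) (Fin 2) ℂ)
    + (c₁ : ℂ) • (pauli 0 ⊗ₖ pauli 0)
    + (c₂ : ℂ) • (pauli 1 ⊗ₖ pauli 1)
    + (c₃ : ℂ) • (pauli 2 ⊗ₖ pauli 2))

/-- The Bell state |β_ab⟩ = (|0,b⟩ + (−1)^a |1,1⊕b⟩)/√2 as a vector in ℂ²⊗ℂ². -/
noncomputable def bellVec (a b : Fin 2) : Fin 2 × Fin 2 → ℂ := fun p =>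
  ((if p = (0, b) then 1 else 0)
    + (-1 : ℂ) ^ (a : ℕ) * (if p = (1, b + 1) then 1 else 0)) / (Real.sqrt 2 : ℂ)

/-- The rank-one projector β_ab = |β_ab⟩⟨β_ab|. -/
noncomputable def bellProj (a b : Fin 2) : Matrix (Fin 2 × Fin 2) (Fin 2 × Fin 2) ℂ :=
  Matrix.vecMulVec (bellVec a b) (star (bellVec a b))

/-- The eigenvalues λ_ab of the Bell-diagonal state. -/
noncomputable def lamBD (c₁ c₂ c₃ : ℝ) (a b : Fin 2) : ℝ :=
  (1 + (-1 : ℝ) ^ (a : ℕ) * c₁ - (-1 : ℝ) ^ ((a : ℕ) + (b : ℕ)) * c₂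
    + (-1 : ℝ) ^ (b : ℕ) * c₃) / 4

/-- Projective measurement operators M_a(A) = (I + (−1)^a A)/2 for a ±1-valued observable A. -/
noncomputable def Mop (a : Fin 2) (A : Matrix (Fin 2) (Fin 2) ℂ) : Matrix (Fin 2) (Fin 2) ℂ :=
  (1 / 2 : ℂ) • ((1 : Matrix (Fin 2) (Fin 2) ℂ) + (-1 : ℂ) ^ (a : ℕ) • A)

/-- Each Bell projector is itself Bell-diagonal, with sign coefficients. -/
theorem bellProj_eq_bellDiag (a b : Fin 2) :
    bellProj a b = bellDiag ((-1) ^ (a : ℕ)) (-(-1) ^ ((a : ℕ) + (b : ℕ))) ((-1) ^ (b : ℕ)) := by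
  have hsq : ((Real.sqrt 2 : ℝ) : ℂ)⁻¹ * ((Real.sqrt 2 : ℝ) : ℂ)⁻¹ = 1 / 2 := by
    rw [← mul_inv, ← Complex.ofReal_mul, Real.mul_self_sqrt zero_le_two]
    norm_num
  ext ⟨i, j⟩ ⟨k, l⟩
  fin_cases a <;> fin_cases b <;> fin_cases i <;> fin_cases j <;> fin_cases k <;> fin_cases l <;>
    simp [bellProj, bellDiag, bellVec, pauli, Matrix.vecMulVec_apply, div_eq_mul_inv, hsq] <;>
    norm_num

/-- The spectral decomposition of a Bell-diagonal matrix. -/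
theorem bellDiag_eq_sum_bellProj (c₁ c₂ c₃ : ℝ) :
    bellDiag c₁ c₂ c₃ = ∑ a, ∑ b, (lamBD c₁ c₂ c₃ a b : ℂ) • bellProj a b := by
  simp only [Fin.sum_univ_two, bellProj_eq_bellDiag, bellDiag, lamBD]
  simp only [Fin.val_zero, Fin.val_one]
  push_cast
  module

/-- Decomposition of a Bell-diagonal state (with c₁ ≥ c₂ ≥ −c₃ ≥ 0 and
c₁+c₂+c₃ ≤ 1) as a convex mixture of the entangled projector β₀₁ with weight |c₃|
and separable pieces; the weights are nonnegative and sum to 1. -/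
theorem bellDiag_three_setting_decomposition (c₁ c₂ c₃ : ℝ)
    (h12 : c₁ ≥ c₂) (h23 : c₂ ≥ -c₃) (h3 : -c₃ ≥ 0)
    (hpos : c₁ + c₂ + c₃ ≤ 1) :
    (bellDiag c₁ c₂ c₃
      = ((|c₃| : ℝ) : ℂ) • bellProj 0 1
        + ((2 * (lamBD c₁ c₂ c₃ 0 0 - lamBD c₁ c₂ c₃ 1 1) : ℝ) : ℂ) •
            ((1 / 2 : ℂ) • (bellProj 0 0 + bellProj 0 1))
        + ((2 * lamBD c₁ c₂ c₃ 1 0 : ℝ) : ℂ) •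
            ((1 / 2 : ℂ) • (bellProj 0 1 + bellProj 1 0))
        + ((2 * lamBD c₁ c₂ c₃ 1 1 : ℝ) : ℂ) •
            ((1 / 2 : ℂ) • (bellProj 0 0 + bellProj 1 1))) ∧
    0 ≤ |c₃| ∧
    0 ≤ 2 * (lamBD c₁ c₂ c₃ 0 0 - lamBD c₁ c₂ c₃ 1 1) ∧
    0 ≤ 2 * lamBD c₁ c₂ c₃ 1 0 ∧
    0 ≤ 2 * lamBD c₁ c₂ c₃ 1 1 ∧
    |c₃| + 2 * (lamBD c₁ c₂ c₃ 0 0 - lamBD c₁ c₂ c₃ 1 1)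
      + 2 * lamBD c₁ c₂ c₃ 1 0 + 2 * lamBD c₁ c₂ c₃ 1 1 = 1 := by
  have habs : |c₃| = -c₃ := abs_of_nonpos (by linarith)
  refine ⟨?_, abs_nonneg _, ?_, ?_, ?_, ?_⟩
  · rw [bellDiag_eq_sum_bellProj, habs]
    simp only [Fin.sum_univ_two, lamBD, Fin.val_zero, Fin.val_one]
    push_cast
    module
  all_goals
    simp only [lamBD, Fin.val_zero, Fin.val_one, habs]
    norm_num
    linarith
end

section
/- Let c₁, c₂, c₃ be real numbers with 0 ≤ −c₃ ≤ c₂ ≤ c₁ ≤ 1 (so c₃ ≤ 0), c₃ > −1, and (1 − c₁)(1 + c₁ + 2c₃) ≥ (c₂ + c₃)². Define the 4×4 matrix ρ_sep = (1/(1+c₃)) [ 2(λ₀₀ − λ₁₁)·(β₀₀ + β₀₁)/2 + 2λ₁₀·(β₀₁ + β₁₀)/2 + 2λ₁₁·(β₀₀ + β₁₁)/2 ]. Consider the three-setting box generated by measuring O₀ = σ₁, O₁ = σ₂, O₂ = σ₃ on both sides of ρ_sep, i.e., P(a,b|x,y) := Tr[(M_a(O_x) ⊗ M_b(O_y)) ρ_sep]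 for a,b ∈ {0,1} and x,y ∈ {0,1,2}. Then this box admits a local hidden variable–local hidden state model of dimension 4: there exist conditional distributions q(a|x,λ) ∈ [0,1] with q(0|x,λ) + q(1|x,λ) = 1, and 2×2 positive semidefinite matrices ρ₀, ρ₁, ρ₂, ρ₃ of unit trace, such that P(a,b|x,y) = Σ_{λ=0}^{3} (1/4) q(a|x,λ) Tr[M_b(O_y) ρ_λ] for all a, b, x, y. -/
open Matrix
open scoped Matrix Kronecker ComplexOrder

/-- The separable state ρ_sep appearing in the three-setting decomposition of the
Bell-diagonal state. -/
noncomputable def rhoSepThree (c₁ c₂ c₃ : ℝ) : Matrix (Fin 2 × Fin 2) (Fin 2 × Fin 2) ℂ :=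
  (((1 + c₃ : ℝ) : ℂ))⁻¹ •
    (((2 * (lamBD c₁ c₂ c₃ 0 0 - lamBD c₁ c₂ c₃ 1 1) : ℝ) : ℂ) •
        ((1 / 2 : ℂ) • (bellProj 0 0 + bellProj 0 1))
      + ((2 * lamBD c₁ c₂ c₃ 1 0 : ℝ) : ℂ) •
        ((1 / 2 : ℂ) • (bellProj 0 1 + bellProj 1 0))
      + ((2 * lamBD c₁ c₂ c₃ 1 1 : ℝ) : ℂ) •
        ((1 / 2 : ℂ) • (bellProj 0 0 + bellProj 1 1)))

theorem bellProj_apply (a b : Fin 2) (p q : Fin 2 × Fin 2) :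
    bellProj a b p q =
      ((if p = (0, b) then 1 else 0) + (-1 : ℂ) ^ (a : ℕ) * (if p = (1, b + 1) then 1 else 0))
      * ((if q = (0, b) then 1 else 0) + (-1 : ℂ) ^ (a : ℕ) * (if q = (1, b + 1) then 1 else 0))
      / 2 := by
  have h2 : ((Real.sqrt 2 : ℝ) : ℂ) * ((Real.sqrt 2 : ℝ) : ℂ) = 2 := by
    rw [← Complex.ofReal_mul, Real.mul_self_sqrt (by norm_num)]
    norm_num
  simp only [bellProj, bellVec, vecMulVec_apply, Pi.star_apply, star_div₀, star_add, star_mul',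
    star_pow, star_neg, star_one, apply_ite (star : ℂ → ℂ), star_zero, Complex.star_def,
    Complex.conj_ofReal]
  rw [div_mul_div_comm, h2]

/-- The correlation `Tr[(σ₁ ⊗ σ₁) ρ_sep]`, and likewise for `σ₂` with `c₂` in place of `c₁`. -/
noncomputable def sepCorr (c c₃ : ℝ) : ℝ := (c + c₃) / (1 + c₃)

theorem rhoSepThree_eq_pauli (c₁ c₂ c₃ : ℝ) (hne : -1 < c₃) :
    rhoSepThree c₁ c₂ c₃ = (1 / 4 : ℂ) •
      ((1 : Matrix (Fin 2) (Fin 2) ℂ) ⊗ₖ (1 : Matrix (Fin 2) (Fin 2) ℂ)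
        + (sepCorr c₁ c₃ : ℂ) • (pauli 0 ⊗ₖ pauli 0)
        + (sepCorr c₂ c₃ : ℂ) • (pauli 1 ⊗ₖ pauli 1)) := by
  have hc : (1 + (c₃ : ℂ)) ≠ 0 := by
    exact_mod_cast (by linarith : (0 : ℝ) < 1 + c₃).ne'
  ext ⟨i, j⟩ ⟨k, l⟩
  fin_cases i <;> fin_cases j <;> fin_cases k <;> fin_cases l <;>
    simp [rhoSepThree, bellProj_apply, lamBD, sepCorr, pauli, kroneckerMap_apply] <;>
    field_simp <;> ring

theorem trace_kronecker_mul_kronecker (A B C D : Matrix (Fin 2) (Fin 2) ℂ) :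
    ((A ⊗ₖ B) * (C ⊗ₖ D)).trace = (A * C).trace * (B * D).trace := by
  rw [← mul_kronecker_mul, trace_kronecker]

/-- The qubit state with Bloch vector `(u, v, 0)`. -/
noncomputable def equatorialState (u v : ℝ) : Matrix (Fin 2) (Fin 2) ℂ :=
  (1 / 2 : ℂ) • ((1 : Matrix (Fin 2) (Fin 2) ℂ) + (u : ℂ) • pauli 0 + (v : ℂ) • pauli 1)

theorem equatorialState_posSemidef {u v : ℝ} (h : u ^ 2 + v ^ 2 ≤ 1) :
    (equatorialState u v).PosSemidef := by
  set r : ℝ := Real.sqrt (1 - u ^ 2 - v ^ 2)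
  have hr : (r : ℂ) * r = 1 - u ^ 2 - v ^ 2 := by
    rw [← Complex.ofReal_mul, Real.mul_self_sqrt (by linarith)]
    push_cast
    ring
  have key : (1 : Matrix (Fin 2) (Fin 2) ℂ) + (u : ℂ) • pauli 0 + (v : ℂ) • pauli 1
      = !![1, 0; u + v * Complex.I, (r : ℂ)] * (!![1, 0; u + v * Complex.I, (r : ℂ)])ᴴ := by
    ext i j
    fin_cases i <;> fin_cases j <;>
      simp [pauli, Matrix.mul_apply, Fin.sum_univ_two, conjTranspose_apply, hr]
    ring_nf
    simp
  rw [equatorialState, key]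
  exact (posSemidef_self_mul_conjTranspose _).smul (by
    rw [Complex.le_def]
    norm_num)

theorem equatorialState_trace (u v : ℝ) : (equatorialState u v).trace = 1 := by
  simp [equatorialState, pauli, trace_fin_two]

theorem trace_Mop (a : Fin 2) (x : Fin 3) : (Mop a (pauli x)).trace = 1 := by
  fin_cases x <;> simp [Mop, pauli, trace_fin_two]

theorem trace_Mop_mul_pauli (a : Fin 2) (x y : Fin 3) :
    (Mop a (pauli x) * pauli y).trace = if x = y then (-1 : ℂ) ^ (a : ℕ) else 0 := by
  fin_cases x <;> fin_cases y <;>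
    simp [Mop, pauli, trace_fin_two, Matrix.mul_apply, Fin.sum_univ_two] <;> ring_nf <;> simp

theorem trace_Mop_mul_equatorialState (b : Fin 2) (y : Fin 3) (u v : ℝ) :
    (Mop b (pauli y) * equatorialState u v).trace = (1 / 2 : ℂ) *
      (1 + u * (if y = 0 then (-1 : ℂ) ^ (b : ℕ) else 0)
        + v * (if y = 1 then (-1 : ℂ) ^ (b : ℕ) else 0)) := by
  simp only [equatorialState, mul_smul_comm, mul_add, mul_one, trace_smul, trace_add, trace_Mop,
    trace_Mop_mul_pauli, smul_eq_mul]

theorem trace_Mop_kronecker_mul_rhoSepThree (c₁ c₂ c₃ : ℝ) (hne : -1 < c₃)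
    (a b : Fin 2) (x y : Fin 3) :
    ((Mop a (pauli x) ⊗ₖ Mop b (pauli y)) * rhoSepThree c₁ c₂ c₃).trace = (1 / 4 : ℂ) *
      (1 + sepCorr c₁ c₃ * ((if x = 0 then (-1 : ℂ) ^ (a : ℕ) else 0)
            * (if y = 0 then (-1 : ℂ) ^ (b : ℕ) else 0))
        + sepCorr c₂ c₃ * ((if x = 1 then (-1 : ℂ) ^ (a : ℕ) else 0)
            * (if y = 1 then (-1 : ℂ) ^ (b : ℕ) else 0))) := by
  rw [rhoSepThree_eq_pauli c₁ c₂ c₃ hne]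
  simp only [mul_smul_comm, Matrix.mul_add, trace_smul, trace_add, trace_kronecker_mul_kronecker,
    Matrix.mul_one, trace_Mop, trace_Mop_mul_pauli, smul_eq_mul, one_mul]

theorem sepCorr_sq_add_sq_le_one {c₁ c₂ c₃ : ℝ} (hne : -1 < c₃)
    (hdisc : (c₂ + c₃) ^ 2 ≤ (1 - c₁) * (1 + c₁ + 2 * c₃)) :
    sepCorr c₁ c₃ ^ 2 + sepCorr c₂ c₃ ^ 2 ≤ 1 := by
  have hpos : 0 < (1 + c₃) ^ 2 := by nlinarith
  rw [sepCorr, sepCorr, div_pow, div_pow, ← add_div, div_le_one hpos]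
  nlinarith

/-- The deterministic outcomes for `σ₁` and `σ₂`, and `0` (a fair coin) for `σ₃`, under each of
the four values of the hidden variable. -/
def hiddenSign : Fin 3 → Fin 4 → ℝ :=
  ![![1, 1, -1, -1], ![1, -1, 1, -1], ![0, 0, 0, 0]]

theorem hiddenSign_mem (x : Fin 3) (l : Fin 4) :
    -1 ≤ hiddenSign x l ∧ hiddenSign x l ≤ 1 := by
  fin_cases x <;> fin_cases l <;> norm_num [hiddenSign]

theorem neg_one_pow_mul_hiddenSign_mem (a : Fin 2) (x : Fin 3) (l : Fin 4) :
    -1 ≤ (-1 : ℝ) ^ (a : ℕ) * hiddenSign x l ∧ (-1 : ℝ) ^ (a : ℕ) * hiddenSign x l ≤ 1 := by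
  obtain ⟨h, h'⟩ := hiddenSign_mem x l
  fin_cases a <;> constructor <;> simp <;> linarith

theorem hiddenSign_sq {x : Fin 3} (hx : x ≠ 2) (l : Fin 4) : hiddenSign x l ^ 2 = 1 := by
  fin_cases x <;> fin_cases l <;> simp_all [hiddenSign]

/-- The box produced by measuring O₀ = σ₁, O₁ = σ₂, O₂ = σ₃ on both sides of
ρ_sep admits a local hidden variable–local hidden state model of dimension 4
with uniform weights. -/
theorem rhoSepThree_LHV_LHS_dim_four (c₁ c₂ c₃ : ℝ)
    (h0 : 0 ≤ -c₃) (h32 : -c₃ ≤ c₂) (h21 : c₂ ≤ c₁) (h1 : c₁ ≤ 1) (hne : -1 < c₃)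
    (hdisc : (c₂ + c₃) ^ 2 ≤ (1 - c₁) * (1 + c₁ + 2 * c₃)) :
    ∃ (q : Fin 2 → Fin 3 → Fin 4 → ℝ) (ρ : Fin 4 → Matrix (Fin 2) (Fin 2) ℂ),
      (∀ a x l, 0 ≤ q a x l) ∧ (∀ a x l, q a x l ≤ 1) ∧
      (∀ x l, q 0 x l + q 1 x l = 1) ∧
      (∀ l, (ρ l).PosSemidef) ∧ (∀ l, (ρ l).trace = 1) ∧
      (∀ (a b : Fin 2) (x y : Fin 3),
        ((Mop a (pauli x) ⊗ₖ Mop b (pauli y)) * rhoSepThree c₁ c₂ c₃).trace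
          = ∑ l : Fin 4,
              ((1 / 4 : ℝ) * q a x l : ℝ) * (Mop b (pauli y) * ρ l).trace) := by
  refine ⟨fun a x l => (1 + (-1 : ℝ) ^ (a : ℕ) * hiddenSign x l) / 2,
    fun l => equatorialState (hiddenSign 0 l * sepCorr c₁ c₃) (hiddenSign 1 l * sepCorr c₂ c₃),
    fun a x l => ?_, fun a x l => ?_, fun x l => ?_, fun l => ?_,
    fun l => equatorialState_trace _ _, fun a b x y => ?_⟩
  · linarith [(neg_one_pow_mul_hiddenSign_mem a x l).1]
  · linarith [(neg_one_pow_mul_hiddenSign_mem a x l).2]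
  · simp
    ring
  · apply equatorialState_posSemidef
    rw [mul_pow, mul_pow, hiddenSign_sq (by decide), hiddenSign_sq (by decide), one_mul, one_mul]
    exact sepCorr_sq_add_sq_le_one hne hdisc
  · simp only [trace_Mop_kronecker_mul_rhoSepThree c₁ c₂ c₃ hne, trace_Mop_mul_equatorialState,
      Fin.sum_univ_four]
    fin_cases x <;> fin_cases y <;> simp [hiddenSign] <;> ring
end
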